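/- Fix 0 < κ < γ ≤ 1 with γ + κ > 1 and T > 0. If x : [0,T] → ℝ is γ-Hölder and m : [0,T] → ℝ is κ-Hölder, then the Riemann–Stieltjes (Young) sums Σ_i m_{t_i}(x_{t_{i+1}} - x_{t_i}) over partitions of [s,t] converge as the mesh tends to 0, and the limit J_{st}(m dx) satisfies |J_{st}(m dx)| ≤ ‖m‖_∞ ‖x‖_γ |t-s|^γ + c_{γ,κ} ‖m‖_κ ‖x‖_γ |t-s|^{γ+κ} for some constant c_{γ,κ} depending only on γ and κ. -/

import Mathlib

open Filter Topology in
lemma young_discrete (θ : ℝ) (hθ : 1 < θ) (M X : ℕ → ℝ) (D : ℝ) (hD : 0 ≤ D)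
    (h : ∀ j a b : ℕ, |(M (j + a) - M j) * (X (j + a + b) - X (j + a))| ≤ D * ((a + b : ℕ) : ℝ) ^ θ)
    (n : ℕ) : ∀ j : ℕ,
    |(∑ i ∈ Finset.range (j + n), M i * (X (i + 1) - X i))
      - (∑ i ∈ Finset.range j, M i * (X (i + 1) - X i)) - M j * (X (j + n) - X j)|
      ≤ (1 - (2 / 3 : ℝ) ^ (θ - 1))⁻¹ * D * (n : ℝ) ^ θ := by
  have hr : (2 / 3 : ℝ) ^ (θ - 1) < 1 :=
    Real.rpow_lt_one (by norm_num) (by norm_num) (by linarith)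
  set r : ℝ := (2 / 3 : ℝ) ^ (θ - 1) with hrdef
  have hC : 0 < (1 - r)⁻¹ := inv_pos.2 (by linarith)
  set C := (1 - r)⁻¹ with hCdef
  have hCr : C * r + 1 = C := by
    have : (1 - r) ≠ 0 := by linarith
    rw [hCdef]; field_simp; ring
  induction n using Nat.strong_induction_on with
  | _ n ih =>
    intro j
    rcases Nat.lt_or_ge n 2 with hn | hn
    · have : n = 0 ∨ n = 1 := by omega
      rcases this with rfl | rfl
      · simp; positivity
      · simp [Finset.sum_range_succ]; positivity
    · obtain ⟨a, b, hab, hba, hb⟩ : ∃ a b : ℕ, a + b = n ∧ a ≤ b ∧ 1 ≤ a ∧ 3 * b ≤ 2 * n :=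
        ⟨n / 2, n - n / 2, by omega, by omega, by omega, by omega⟩
      obtain ⟨ha1, hb⟩ := hb
      have h1 := ih a (by omega) j
      have h2 := ih b (by omega) (j + a)
      have h3 := h j a b
      have hjn : j + a + b = j + n := by omega
      rw [hab] at h3
      rw [hjn] at h2 h3
      have hpow : (a : ℝ) ^ θ + (b : ℝ) ^ θ ≤ r * (n : ℝ) ^ θ := by
        have ha0 : (0 : ℝ) < a := by exact_mod_cast ha1
        have hab' : (a : ℝ) ≤ b := by exact_mod_cast hba
        have hb0 : (0 : ℝ) < b := lt_of_lt_of_le ha0 hab'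
        have hn' : (a : ℝ) + b = n := by exact_mod_cast hab
        have hb' : (b : ℝ) ≤ 2 / 3 * n := by
          have : (3 : ℝ) * b ≤ 2 * n := by exact_mod_cast hb
          linarith
        have hn0 : (0 : ℝ) < n := by linarith
        have split : ∀ y : ℝ, 0 < y → y ^ θ = y ^ (θ - 1) * y := by
          intro y hy
          rw [Real.rpow_sub_one hy.ne']; field_simp
        have hk : (b : ℝ) ^ (θ - 1) ≤ r * (n : ℝ) ^ (θ - 1) := by
          rw [hrdef, ← Real.mul_rpow (by norm_num) hn0.le]
          exact Real.rpow_le_rpow hb0.le hb' (by linarith)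
        have hk2 : (a : ℝ) ^ (θ - 1) ≤ (b : ℝ) ^ (θ - 1) :=
          Real.rpow_le_rpow ha0.le hab' (by linarith)
        rw [split a ha0, split b hb0, split n hn0]
        calc (a : ℝ) ^ (θ - 1) * a + (b : ℝ) ^ (θ - 1) * b
            ≤ (b : ℝ) ^ (θ - 1) * a + (b : ℝ) ^ (θ - 1) * b := by gcongr
          _ = (b : ℝ) ^ (θ - 1) * n := by rw [← hn']; ring
          _ ≤ r * (n : ℝ) ^ (θ - 1) * n := by gcongr
          _ = _ := by ring
      have hfin : C * D * (a : ℝ) ^ θ + C * D * (b : ℝ) ^ θ + D * (n : ℝ) ^ θ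
          ≤ C * D * (n : ℝ) ^ θ := by
        have := mul_le_mul_of_nonneg_left hpow (mul_nonneg hC.le hD)
        have e : C * D * (n : ℝ) ^ θ = C * D * (r * (n : ℝ) ^ θ) + D * (n : ℝ) ^ θ := by
          linear_combination (- D * (n : ℝ) ^ θ) * hCr
        rw [e]; linarith
      refine le_trans ?_ hfin
      rw [abs_le] at h1 h2 h3 ⊢
      constructor <;> nlinarith

open Filter Topology in
lemma young_primitive (γ κ : ℝ) (hκ : 0 < κ) (hγ : 0 < γ) (hsum : 1 < γ + κ)
    (x m : ℝ → ℝ) (Cx Cm : ℝ) (hCx : 0 ≤ Cx) (hCm : 0 ≤ Cm)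
    (hx : ∀ u v, |x v - x u| ≤ Cx * |v - u| ^ γ)
    (hm : ∀ u v, |m v - m u| ≤ Cm * |v - u| ^ κ) :
    ∃ F : ℝ → ℝ, ∀ a b, 0 ≤ a → a ≤ b →
      |F b - F a - m a * (x b - x a)| ≤
        (1 - (2 / 3 : ℝ) ^ (γ + κ - 1))⁻¹ * (Cm * Cx) * (b - a) ^ (γ + κ) := by
  set C := (1 - (2 / 3 : ℝ) ^ (γ + κ - 1))⁻¹ with hCdef
  have hC : 0 < C := inv_pos.2 (by
    linarith [Real.rpow_lt_one (x := (2/3 : ℝ)) (by norm_num) (by norm_num)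
      (show 0 < γ + κ - 1 by linarith)])
  let g : ℕ → ℝ → ℝ := fun N t => (⌊t * (N + 1)⌋₊ : ℝ) / (N + 1)
  let S : ℕ → ℝ → ℝ := fun N t => ∑ i ∈ Finset.range ⌊t * (N + 1)⌋₊,
    m ((i : ℝ) / (N + 1)) * (x (((i + 1 : ℕ) : ℝ) / (N + 1)) - x ((i : ℝ) / (N + 1)))
  have key : ∀ N a b, 0 ≤ a → a ≤ b →
      |S N b - S N a - m (g N a) * (x (g N b) - x (g N a))| ≤
        C * (Cm * Cx) * (g N b - g N a) ^ (γ + κ) := by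
    intro N a b ha hab
    have hN : (0 : ℝ) < N + 1 := by positivity
    have hle : ⌊a * ((N : ℝ) + 1)⌋₊ ≤ ⌊b * ((N : ℝ) + 1)⌋₊ := Nat.floor_mono (by gcongr)
    obtain ⟨n, hn⟩ := Nat.exists_eq_add_of_le hle
    have := young_discrete (γ + κ) hsum (fun i : ℕ => m ((i : ℝ) / (N + 1)))
      (fun i : ℕ => x ((i : ℝ) / (N + 1))) (Cm * Cx * (1 / ((N : ℝ) + 1)) ^ (γ + κ))
      (by positivity) (by
        intro j p q
        rw [abs_mul]
        have h1 := hm ((j : ℝ) / (N + 1)) (((j + p : ℕ) : ℝ) / (N + 1))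
        have h2 := hx (((j + p : ℕ) : ℝ) / (N + 1)) (((j + p + q : ℕ) : ℝ) / (N + 1))
        have e1 : |((j + p : ℕ) : ℝ) / (N + 1) - (j : ℝ) / (N + 1)| ≤ ((p + q : ℕ) : ℝ) / (N + 1) := by
          rw [← sub_div, abs_div, abs_of_pos hN]
          gcongr
          push_cast
          rw [abs_of_nonneg] <;> [linarith [(Nat.cast_nonneg q : (0:ℝ) ≤ q)]; skip]
          linarith [(Nat.cast_nonneg p : (0:ℝ) ≤ p)]
        have e2 : |((j + p + q : ℕ) : ℝ) / (N + 1) - ((j + p : ℕ) : ℝ) / (N + 1)|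
            ≤ ((p + q : ℕ) : ℝ) / (N + 1) := by
          rw [← sub_div, abs_div, abs_of_pos hN]
          gcongr
          push_cast
          rw [abs_of_nonneg] <;> [linarith [(Nat.cast_nonneg p : (0:ℝ) ≤ p)]; skip]
          linarith [(Nat.cast_nonneg q : (0:ℝ) ≤ q)]
        set d : ℝ := ((p + q : ℕ) : ℝ) / (N + 1) with hd
        have hd0 : 0 ≤ d := by positivity
        calc _ ≤ (Cm * d ^ κ) * (Cx * d ^ γ) := by
              apply mul_le_mul (h1.trans _) (h2.trans _) (abs_nonneg _) (by positivity)
              · gcongr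
              · gcongr
          _ = Cm * Cx * d ^ (γ + κ) := by
              rw [Real.rpow_add' hd0 (by linarith)]; ring
          _ = _ := by
              rw [hd, div_eq_mul_one_div, Real.mul_rpow (by positivity) (by positivity)]; ring)
      n ⌊a * ((N : ℝ) + 1)⌋₊
    rw [← hn] at this
    refine this.trans (le_of_eq ?_)
    have hg : g N b - g N a = n * (1 / ((N : ℝ) + 1)) := by
      simp only [g]; rw [hn]; push_cast; field_simp; ring
    rw [hg, Real.mul_rpow (by positivity) (by positivity)]; ring
  have g0 : ∀ N, g N 0 = 0 := by intro N; simp [g]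
  have gn : ∀ N t, 0 ≤ g N t := by intro N t; simp only [g]; positivity
  have gle : ∀ N t, 0 ≤ t → g N t ≤ t := by
    intro N t ht
    simp only [g]
    rw [div_le_iff₀ (by positivity)]
    exact Nat.floor_le (by positivity)
  have glim : ∀ t, 0 ≤ t → Tendsto (fun N => g N t) atTop (𝓝 t) := by
    intro t ht
    have h1 : Tendsto (fun N : ℕ => t - 1 / ((N : ℝ) + 1)) atTop (𝓝 t) := by
      simpa using tendsto_const_nhds.sub (tendsto_one_div_add_atTop_nhds_zero_nat (𝕜 := ℝ))
    refine tendsto_of_tendsto_of_tendsto_of_le_of_le h1 tendsto_const_nhds ?_ (fun N => gle N t ht)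
    intro N
    have hN : (0 : ℝ) < N + 1 := by positivity
    simp only [g]
    rw [le_div_iff₀ hN, sub_mul, one_div_mul_cancel hN.ne']
    linarith [Nat.lt_floor_add_one (t * ((N : ℝ) + 1))]
  have hcont : ∀ (f : ℝ → ℝ) (K α : ℝ), 0 < α → (∀ u v, |f v - f u| ≤ K * |v - u| ^ α) →
      Continuous f := by
    intro f K α hα hf
    rw [continuous_iff_continuousAt]
    intro u
    rw [ContinuousAt, tendsto_iff_dist_tendsto_zero]
    refine squeeze_zero (fun _ => dist_nonneg) (fun v => (hf u v)) ?_
    have : Continuous fun v : ℝ => K * |v - u| ^ α := by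
      refine continuous_const.mul (Continuous.rpow_const (by fun_prop) (fun _ => Or.inr hα.le))
    have h := this.tendsto u
    simpa [Real.zero_rpow hα.ne'] using h
  have xc := hcont x Cx γ hγ hx
  have mc := hcont m Cm κ hκ hm
  have hbd : ∀ t, 0 ≤ t → ∃ B, ∀ N, S N t ∈ Set.Icc (-B) B := by
    intro t ht
    refine ⟨|m 0| * (Cx * t ^ γ) + C * (Cm * Cx) * t ^ (γ + κ), fun N => ?_⟩
    have h := key N 0 t le_rfl ht
    have hS0 : S N 0 = 0 := by simp [S]
    rw [hS0, g0, sub_zero, sub_zero] at h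
    have h2 : |m 0 * (x (g N t) - x 0)| ≤ |m 0| * (Cx * t ^ γ) := by
      rw [abs_mul]
      gcongr
      refine (hx 0 (g N t)).trans ?_
      rw [sub_zero, abs_of_nonneg (gn N t)]
      gcongr
      exact gle N t ht
    have h3 : C * (Cm * Cx) * (g N t) ^ (γ + κ) ≤ C * (Cm * Cx) * t ^ (γ + κ) := by
      gcongr
      exact gle N t ht
    rw [abs_le] at h h2
    constructor <;> linarith [h.1, h.2, h2.1, h2.2]
  have hex : ∀ t, ∃ y, 0 ≤ t → Tendsto (fun N => S N t) (hyperfilter ℕ : Filter ℕ) (𝓝 y) := by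
    intro t
    by_cases ht : 0 ≤ t
    · obtain ⟨B, hB⟩ := hbd t ht
      obtain ⟨y, -, hy⟩ := (isCompact_Icc (a := -B) (b := B)).ultrafilter_le_nhds
        ((hyperfilter ℕ).map (fun N => S N t)) (by
          rw [Ultrafilter.coe_map, le_principal_iff, mem_map]
          exact Filter.univ_mem' hB)
      exact ⟨y, fun _ => hy⟩
    · exact ⟨0, fun h => absurd h ht⟩
  choose F hF using hex
  refine ⟨F, fun a b ha hab => ?_⟩
  have hb := ha.trans hab
  have ga := (glim a ha).mono_left Nat.hyperfilter_le_atTop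
  have gb := (glim b hb).mono_left Nat.hyperfilter_le_atTop
  have L := (((hF b hb).sub (hF a ha)).sub (((mc.tendsto a).comp ga).mul
    (((xc.tendsto b).comp gb).sub ((xc.tendsto a).comp ga)))).abs
  have R : Tendsto (fun N => C * (Cm * Cx) * (g N b - g N a) ^ (γ + κ))
      (hyperfilter ℕ : Filter ℕ) (𝓝 (C * (Cm * Cx) * (b - a) ^ (γ + κ))) :=
    ((gb.sub ga).rpow_const (Or.inr (by linarith))).const_mul _
  exact le_of_tendsto_of_tendsto' L R (fun N => key N a b ha hab)

/-- Young integral: fix `0 < κ < γ ≤ 1` with `γ + κ > 1`.  There is a constant `c = c_{γ,κ}`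
such that for every `T > 0`, every `γ`-Hölder `x` and `κ`-Hölder `m` on `[0,T]` (with Hölder
constants `Cx`, `Cm` and sup bound `Cinf` for `m`), and every `0 ≤ s ≤ t ≤ T`, the Riemann
sums `∑ m_{t_i}(x_{t_{i+1}} - x_{t_i})` over partitions of `[s,t]` converge as the mesh tends
to `0`, and the limit `J` satisfies
`|J| ≤ Cinf * Cx * (t-s)^γ + c * Cm * Cx * (t-s)^{γ+κ}`. -/
theorem young_integral_exists (γ κ : ℝ) (hκ : 0 < κ) (hκγ : κ < γ) (hγ : γ ≤ 1)
    (hsum : 1 < γ + κ) :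
    ∃ c : ℝ, ∀ T : ℝ, 0 < T → ∀ x m : ℝ → ℝ, ∀ Cx Cm Cinf : ℝ,
      (∀ u ∈ Set.Icc (0 : ℝ) T, ∀ v ∈ Set.Icc (0 : ℝ) T, |x v - x u| ≤ Cx * |v - u| ^ γ) →
      (∀ u ∈ Set.Icc (0 : ℝ) T, ∀ v ∈ Set.Icc (0 : ℝ) T, |m v - m u| ≤ Cm * |v - u| ^ κ) →
      (∀ u ∈ Set.Icc (0 : ℝ) T, |m u| ≤ Cinf) →
      ∀ s t : ℝ, 0 ≤ s → s ≤ t → t ≤ T →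
      ∃ J : ℝ,
        (∀ ε > 0, ∃ δ > 0, ∀ n : ℕ, ∀ p : Fin (n + 1) → ℝ,
          Monotone p → p 0 = s → p (Fin.last n) = t →
          (∀ i : Fin n, p i.succ - p i.castSucc < δ) →
          |(∑ i : Fin n, m (p i.castSucc) * (x (p i.succ) - x (p i.castSucc))) - J| < ε) ∧
        |J| ≤ Cinf * Cx * (t - s) ^ γ + c * Cm * Cx * (t - s) ^ (γ + κ) := by
  have hγ0 : 0 < γ := hκ.trans hκγ
  refine ⟨(1 - (2 / 3 : ℝ) ^ (γ + κ - 1))⁻¹, ?_⟩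
  intro T hT x m Cx Cm Cinf hx hm hi s t hs hst htT
  set C := (1 - (2 / 3 : ℝ) ^ (γ + κ - 1))⁻¹ with hCdef
  have hC : 0 < C := inv_pos.2 (by
    linarith [Real.rpow_lt_one (x := (2/3 : ℝ)) (by norm_num) (by norm_num)
      (show 0 < γ + κ - 1 by linarith)])
  have h0mem : (0 : ℝ) ∈ Set.Icc (0 : ℝ) T := ⟨le_rfl, hT.le⟩
  have hTmem : T ∈ Set.Icc (0 : ℝ) T := ⟨hT.le, le_rfl⟩
  have hpos : ∀ K α : ℝ, 0 ≤ K * |T - 0| ^ α → 0 ≤ K := by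
    intro K α h
    rw [sub_zero, abs_of_pos hT] at h
    exact nonneg_of_mul_nonneg_left h (Real.rpow_pos_of_pos hT α)
  have hCx : 0 ≤ Cx := hpos Cx γ ((abs_nonneg _).trans (hx 0 h0mem T hTmem))
  have hCm : 0 ≤ Cm := hpos Cm κ ((abs_nonneg _).trans (hm 0 h0mem T hTmem))
  let P : ℝ → ℝ := fun u => (Set.projIcc 0 T hT.le u : ℝ)
  have hP : ∀ u, P u ∈ Set.Icc (0 : ℝ) T := fun u => (Set.projIcc 0 T hT.le u).2
  have hPid : ∀ u ∈ Set.Icc (0 : ℝ) T, P u = u := by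
    intro u hu
    simp only [P]; rw [Set.projIcc_of_mem hT.le hu]
  have hPl : ∀ u v, |P v - P u| ≤ |v - u| := fun u v => Set.abs_projIcc_sub_projIcc hT.le
  obtain ⟨F, hF⟩ := young_primitive γ κ hκ hγ0 hsum (fun u => x (P u)) (fun u => m (P u)) Cx Cm
    hCx hCm
    (fun u v => (hx _ (hP u) _ (hP v)).trans (by have := hPl u v; gcongr))
    (fun u v => (hm _ (hP u) _ (hP v)).trans (by have := hPl u v; gcongr))
  have hF' : ∀ a b, 0 ≤ a → a ≤ b → b ≤ T →
      |F b - F a - m a * (x b - x a)| ≤ C * (Cm * Cx) * (b - a) ^ (γ + κ) := by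
    intro a b ha hab hb
    have h := hF a b ha hab
    simp only [hPid a ⟨ha, hab.trans hb⟩, hPid b ⟨ha.trans hab, hb⟩] at h
    exact h
  refine ⟨F t - F s, ?_, ?_⟩
  · intro ε hε
    set A := C * (Cm * Cx) with hA
    have hA0 : 0 ≤ A := by positivity
    have hθ : 0 < γ + κ - 1 := by linarith
    have hB : 0 < A * (t - s) + 1 := by
      have : 0 ≤ t - s := by linarith
      positivity
    refine ⟨(ε / (A * (t - s) + 1)) ^ (1 / (γ + κ - 1)), by positivity, ?_⟩
    intro n p hp hp0 hpn hmesh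
    set δ := (ε / (A * (t - s) + 1)) ^ (1 / (γ + κ - 1)) with hδ
    have hδpow : δ ^ (γ + κ - 1) = ε / (A * (t - s) + 1) := by
      rw [hδ, ← Real.rpow_mul (by positivity), one_div_mul_cancel hθ.ne', Real.rpow_one]
    have tel : ∀ f : ℝ → ℝ, ∑ i : Fin n, (f (p i.succ) - f (p i.castSucc)) = f t - f s := by
      intro f
      rw [Finset.sum_sub_distrib]
      have h1 := Fin.sum_univ_succ (fun i : Fin (n + 1) => f (p i))
      have h2 := Fin.sum_univ_castSucc (fun i : Fin (n + 1) => f (p i))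
      rw [hp0] at h1
      rw [hpn] at h2
      linarith
    have hterm : ∀ i : Fin n,
        |m (p i.castSucc) * (x (p i.succ) - x (p i.castSucc)) - (F (p i.succ) - F (p i.castSucc))|
          ≤ A * (ε / (A * (t - s) + 1)) * (p i.succ - p i.castSucc) := by
      intro i
      have hle : p i.castSucc ≤ p i.succ := hp (Fin.castSucc_lt_succ).le
      have hl : 0 ≤ p i.castSucc := hs.trans (hp0 ▸ hp (Fin.zero_le _))
      have hr : p i.succ ≤ T := le_trans (hpn ▸ hp (Fin.le_last _)) htT
      rw [abs_sub_comm]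
      refine (hF' _ _ hl hle hr).trans ?_
      set d := p i.succ - p i.castSucc with hd
      have hd0 : 0 ≤ d := by linarith
      have e : d ^ (γ + κ) = d ^ (γ + κ - 1) * d := by
        have := Real.rpow_add' (x := d) hd0 (y := γ + κ - 1) (z := 1) (by linarith)
        rw [Real.rpow_one] at this
        rw [← this]; congr 1; ring
      rw [e, ← hδpow, ← mul_assoc]
      have := (hmesh i).le
      gcongr
    rw [← tel F, ← Finset.sum_sub_distrib]
    refine lt_of_le_of_lt ((Finset.abs_sum_le_sum_abs _ _).trans
      (Finset.sum_le_sum fun i _ => hterm i)) ?_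
    rw [← Finset.mul_sum, tel (fun u => u)]
    have : A * (ε / (A * (t - s) + 1)) * (t - s) = ε * (A * (t - s)) / (A * (t - s) + 1) := by
      ring
    rw [this, div_lt_iff₀ hB]
    nlinarith
  · have h := hF' s t hs hst htT
    have hsm : s ∈ Set.Icc (0 : ℝ) T := ⟨hs, hst.trans htT⟩
    have h1 := hx s hsm t ⟨hs.trans hst, htT⟩
    rw [abs_of_nonneg (sub_nonneg.2 hst)] at h1
    have h2 : |m s * (x t - x s)| ≤ Cinf * (Cx * (t - s) ^ γ) := by
      rw [abs_mul]
      exact mul_le_mul (hi s hsm) h1 (abs_nonneg _) ((abs_nonneg _).trans (hi s hsm))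
    have h3 : |F t - F s| ≤ |F t - F s - m s * (x t - x s)| + |m s * (x t - x s)| := by
      have := abs_add_le (F t - F s - m s * (x t - x s)) (m s * (x t - x s))
      rwa [sub_add_cancel] at this
    have e : C * Cm * Cx = C * (Cm * Cx) := by ring
    rw [e]
    linarith
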